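/- Let F = ℚ(√5), ω = (1−√5)/2, B = ℍ[F, −3, √5], and let O be the O_F-submodule of B generated by BG₁ = 1, BG₂ = 1 + (ω/2)·j + (1/2)·k, BG₃ = (1−ω)/2 + (ω/2)·i, BG₄ = 1 + ω·j (the maximal order of B). Then there exists an element G₀ ∈ O with G₀² = −23 in B, so that the CM field M = ℚ(√5, √−23) embeds into B with √−23 mapped into O. -/

import Mathlib

set_option synthInstance.maxHeartbeats 1000000
set_option maxHeartbeats 1000000

/-! Statement 7: the maximal order O of B = ℍ[ℚ(√5), −3, √5] contains G₀ with G₀² = −23; hence M = ℚ(√5, √−23) embeds into B with √−23 ↦ G₀ ∈ O. -/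

open IntermediateField NumberField Quaternion

noncomputable section

/-- `F = ℚ(√5)` as a subfield of `ℝ`. -/
abbrev F5 : IntermediateField ℚ ℝ := ℚ⟮Real.sqrt 5⟯

/-- `√5` as an element of `F = ℚ(√5)`. -/
def sqrt5 : F5 := ⟨Real.sqrt 5, IntermediateField.mem_adjoin_simple_self ℚ _⟩

/-- `ω = (1 − √5)/2 ∈ F`. -/
def ω5 : F5 := (1 - sqrt5) / 2

/-- The quaternion algebra `B = ℍ[F, −3, √5]` (so `i² = −3`, `j² = √5`, `k = i·j`,
`j·i = −k`). -/
abbrev Bq : Type _ := ℍ[F5, -3, sqrt5]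

def BG₁ : Bq := ⟨1, 0, 0, 0⟩
def BG₂ : Bq := ⟨1, 0, ω5 / 2, 1 / 2⟩
def BG₃ : Bq := ⟨(1 - ω5) / 2, ω5 / 2, 0, 0⟩
def BG₄ : Bq := ⟨1, 0, ω5, 0⟩

/-- The maximal order `O` of `B`. -/
def Oord : Submodule (𝓞 F5) Bq := Submodule.span (𝓞 F5) {BG₁, BG₂, BG₃, BG₄}

/-- The CM field `M = ℚ(√5, √−23)` as a subfield of `ℂ`. -/
abbrev M23 : IntermediateField ℚ ℂ :=
  IntermediateField.adjoin ℚ {(Real.sqrt 5 : ℂ), Complex.I * Real.sqrt 23}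

/-- `√−23 = i·√23` as an element of `M`. -/
def sqrtNeg23 : M23 :=
  ⟨Complex.I * Real.sqrt 23,
    IntermediateField.subset_adjoin ℚ _ (Set.mem_insert_of_mem _ rfl)⟩

lemma sqrt5_sq : sqrt5 ^ 2 = 5 :=
  Subtype.ext (Real.sq_sqrt (by norm_num))

lemma ω5_sq : ω5 ^ 2 = ω5 + 1 := by
  unfold ω5
  linear_combination sqrt5_sq / 4

lemma isIntegral_ω5 : IsIntegral ℤ ω5 :=
  ⟨Polynomial.X ^ 2 - Polynomial.X - 1, by monicity!, by
    simp only [Polynomial.eval₂_sub, Polynomial.eval₂_pow, Polynomial.eval₂_X,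
      Polynomial.eval₂_one]
    linear_combination ω5_sq⟩

/-- `ω` as an element of `O_F`. -/
def ω5Int : 𝓞 F5 := ⟨ω5, isIntegral_ω5⟩

lemma smul_eq_coe_mul (r : 𝓞 F5) (a b c d : F5) :
    r • (⟨a, b, c, d⟩ : Bq) = ⟨(r : F5) * a, r * b, r * c, r * d⟩ := by
  ext : 1 <;> simp [Algebra.smul_def]

/-- The element of `O` given by `(1 + √5)·i + ((1 + √5)/2)·j + ((1 - √5)/2)·k`. -/
def sqrtNeg23Quaternion : Bq := ⟨0, 2 - 2 * ω5, 1 - ω5, ω5⟩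

lemma sqrtNeg23Quaternion_mem_Oord : sqrtNeg23Quaternion ∈ Oord := by
  have h : sqrtNeg23Quaternion = (8 - 6 * ω5Int) • BG₁ + (2 * ω5Int) • BG₂ +
      (4 * ω5Int - 8) • BG₃ + (-2 : 𝓞 F5) • BG₄ := by
    have hω : ((ω5Int : 𝓞 F5) : F5) = ω5 := rfl
    simp only [BG₁, BG₂, BG₃, BG₄, smul_eq_coe_mul, sqrtNeg23Quaternion, map_sub, map_mul, map_neg,
      map_ofNat, hω]
    ext : 1 <;> simp only [QuaternionAlgebra.re_add, QuaternionAlgebra.imI_add,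
      QuaternionAlgebra.imJ_add, QuaternionAlgebra.imK_add]
    · linear_combination 2 * ω5_sq
    · linear_combination (-2) * ω5_sq
    · linear_combination -ω5_sq
    · ring
  rw [h]
  refine add_mem (add_mem (add_mem ?_ ?_) ?_) ?_ <;>
    exact Submodule.smul_mem _ _ (Submodule.subset_span (by simp))

lemma sqrt5_eq : sqrt5 = 1 - 2 * ω5 := by
  unfold ω5
  ring

lemma sqrtNeg23Quaternion_mul_self : sqrtNeg23Quaternion * sqrtNeg23Quaternion = -23 := by
  have h23 : (-23 : Bq) = ((-23 : F5) : Bq) := by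
    rw [QuaternionAlgebra.coe_neg, QuaternionAlgebra.coe_ofNat]
  rw [h23]
  ext : 1 <;> simp only [sqrtNeg23Quaternion, QuaternionAlgebra.mk_mul_mk, QuaternionAlgebra.re_coe,
    QuaternionAlgebra.imI_coe, QuaternionAlgebra.imJ_coe, QuaternionAlgebra.imK_coe, sqrt5_eq]
  · linear_combination (-8 * ω5 - 12) * ω5_sq
  all_goals ring

/-- The complex numbers `a + b√−23` with `a, b ∈ F`. -/
def quadraticField23 : IntermediateField ℚ ℂ where
  carrier := {z | z.re ∈ F5 ∧ z.im / Real.sqrt 23 ∈ F5}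
  mul_mem' := by
    rintro x y ⟨hx, hx'⟩ ⟨hy, hy'⟩
    have h : Real.sqrt 23 ^ 2 = 23 := by simp
    refine ⟨?_, ?_⟩
    · rw [Complex.mul_re, show x.im * y.im =
        23 * ((x.im / Real.sqrt 23) * (y.im / Real.sqrt 23)) by field_simp; rw [h]]
      exact sub_mem (mul_mem hx hy) (mul_mem (ofNat_mem F5 23) (mul_mem hx' hy'))
    · rw [Complex.mul_im, add_div, mul_div_assoc, mul_div_right_comm]
      exact add_mem (mul_mem hx hy') (mul_mem hx' hy)
  add_mem' := by
    rintro x y ⟨hx, hx'⟩ ⟨hy, hy'⟩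
    refine ⟨add_mem hx hy, ?_⟩
    rw [Complex.add_im, add_div]
    exact add_mem hx' hy'
  algebraMap_mem' q := by
    refine ⟨?_, ?_⟩
    · simp
    · simp
  inv_mem' := by
    rintro x ⟨hx, hx'⟩
    have h : Real.sqrt 23 ^ 2 = 23 := by simp
    have hn : Complex.normSq x ∈ F5 := by
      rw [Complex.normSq_apply, show x.im * x.im =
        23 * ((x.im / Real.sqrt 23) * (x.im / Real.sqrt 23)) by field_simp; rw [h]]
      exact add_mem (mul_mem hx hx) (mul_mem (ofNat_mem F5 23) (mul_mem hx' hx'))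
    refine ⟨?_, ?_⟩
    · rw [Complex.inv_re]
      exact div_mem hx hn
    · rw [Complex.inv_im, div_right_comm, neg_div]
      exact div_mem (neg_mem hx') hn

lemma M23_le_quadraticField23 : M23 ≤ quadraticField23 := by
  rw [IntermediateField.adjoin_le_iff]
  rintro z (rfl | rfl)
  · exact ⟨sqrt5.2, by simp⟩
  · exact ⟨by simp, by simp⟩

/-- The rational part `a` of `a + b√−23 ∈ M`. -/
def M23.fst (z : M23) : F5 := ⟨(z : ℂ).re, (M23_le_quadraticField23 z.2).1⟩

/-- The coefficient `b` of `a + b√−23 ∈ M`. -/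
def M23.snd (z : M23) : F5 := ⟨(z : ℂ).im / Real.sqrt 23, (M23_le_quadraticField23 z.2).2⟩

lemma M23.fst_mul (x y : M23) :
    M23.fst (x * y) = M23.fst x * M23.fst y - 23 * (M23.snd x * M23.snd y) := by
  apply Subtype.ext
  have h : Real.sqrt 23 ^ 2 = 23 := by simp
  change ((x : ℂ) * y).re = (x : ℂ).re * (y : ℂ).re -
    23 * ((x : ℂ).im / Real.sqrt 23 * ((y : ℂ).im / Real.sqrt 23))
  rw [Complex.mul_re]
  field_simp
  rw [h]
  ring

lemma M23.snd_mul (x y : M23) :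
    M23.snd (x * y) = M23.fst x * M23.snd y + M23.snd x * M23.fst y := by
  apply Subtype.ext
  change ((x : ℂ) * y).im / Real.sqrt 23 = (x : ℂ).re * ((y : ℂ).im / Real.sqrt 23) +
    (x : ℂ).im / Real.sqrt 23 * (y : ℂ).re
  rw [Complex.mul_im]
  ring

lemma M23.fst_add (x y : M23) : M23.fst (x + y) = M23.fst x + M23.fst y := rfl

lemma M23.snd_add (x y : M23) : M23.snd (x + y) = M23.snd x + M23.snd y :=
  Subtype.ext (add_div _ _ _)

lemma M23.fst_one : M23.fst 1 = 1 := rfl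

lemma M23.snd_one : M23.snd 1 = 0 := Subtype.ext (zero_div _)

/-- The embedding of `M` into an `F`-algebra determined by a square root of `-23`. -/
def M23.lift {A : Type*} [Ring A] [Algebra F5 A] (g : A) (hg : g * g = -23) : M23 →+* A :=
  RingHom.mk'
    { toFun := fun z => algebraMap F5 A (M23.fst z) + M23.snd z • g
      map_one' := by rw [M23.fst_one, M23.snd_one, map_one, zero_smul, add_zero]
      map_mul' := fun x y => by
        have hg' : g * g = (-23 : F5) • (1 : A) := by
          rw [hg, ← Algebra.algebraMap_eq_smul_one, map_neg, map_ofNat]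
        simp only [M23.fst_mul, M23.snd_mul, mul_add, add_mul, hg',
          Algebra.algebraMap_eq_smul_one, smul_mul_assoc, mul_smul_comm, one_mul, mul_one]
        module }
    fun x y => by
      simp only [MonoidHom.coe_mk, OneHom.coe_mk, M23.fst_add, M23.snd_add, map_add, add_smul]
      abel

lemma M23.lift_sqrtNeg23 {A : Type*} [Ring A] [Algebra F5 A] (g : A) (hg : g * g = -23) :
    M23.lift g hg sqrtNeg23 = g := by
  have h₁ : M23.fst sqrtNeg23 = 0 := Subtype.ext (by simp [M23.fst, sqrtNeg23])
  have h₂ : M23.snd sqrtNeg23 = 1 := Subtype.ext (by simp [M23.snd, sqrtNeg23])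
  change algebraMap F5 A (M23.fst sqrtNeg23) + M23.snd sqrtNeg23 • g = g
  rw [h₁, h₂, map_zero, one_smul, zero_add]

theorem exists_G0_sq_eq_neg_23 :
    ∃ G₀ ∈ Oord, G₀ ^ 2 = -23 ∧
      ∃ f : M23 →+* Bq, f sqrtNeg23 = G₀ :=
  ⟨sqrtNeg23Quaternion, sqrtNeg23Quaternion_mem_Oord,
    (sq _).trans sqrtNeg23Quaternion_mul_self,
    M23.lift _ sqrtNeg23Quaternion_mul_self, M23.lift_sqrtNeg23 _ _⟩

end
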